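/- Let (Δ,Θ) be a directive bi-sequence with associated prefixes (w_n) and let n ≥ 2. Suppose the prefix of length n of (Δ,Θ) is normalized, exactly two pseudopalindromic prefixes v₁, v₂ with |v₁| < |v₂| are missed between w_n and w_{n+1}, |v₂| < 2|w_n| (the prefix occurrence of w_n in w_{n+1} overlaps the occurrence of an image of w_n that is a suffix of v₂), and additionally |w_{n+1}| < 2|w_n| (the prefix occurrence of w_n overlaps the suffix occurrence of an image of w_n in w_{n+1}). Then the suffix of w_n of length 2|w_n| − |v₂| is an image of w_{n−2}; in particular |v₂| = 2|w_n| − |w_{n−2}|. -/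

import Mathlib

/-- The ternary alphabet. -/
abbrev Letter := Fin 3

/-- Finite words over the ternary alphabet. -/
abbrev Word := List Letter

/-- The four involutory antimorphisms of ternary words: the reversal `R`
and, for each letter `i`, the antimorphism `E i`. -/
inductive AM where
  | R : AM
  | E : Letter → AM
deriving DecidableEq

/-- The action of an antimorphism on a single letter: `R` fixes every letter,
and `E i` fixes `i` and exchanges the other two letters (in `Fin 3`,
this involution is `a ↦ -(i + a)`). -/
def AM.letter : AM → Letter → Letter
  | .R, _a => _a
  | .E i, a => -(i + a)

/-- The action of an antimorphism on a word: letterwise image followed by reversal. -/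
def AM.apply (t : AM) (w : Word) : Word := (w.map t.letter).reverse

/-- A word is a pseudopalindrome if it is a `ϑ`-palindrome for some
`ϑ ∈ {R, E_0, E_1, E_2}`. -/
def IsPseudopal (w : Word) : Prop := ∃ t : AM, t.apply w = w

/-- `v` is an image of `w` if `v = ϑ(w)` for some `ϑ ∈ {R, E_0, E_1, E_2}`. -/
def IsImage (w v : Word) : Prop := ∃ t : AM, v = t.apply w

/-- `v` is the `ϑ`-palindromic closure of `u`: the shortest `ϑ`-palindrome
having `u` as a prefix. -/
def IsPalClosure (t : AM) (u v : Word) : Prop :=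
  u <+: v ∧ t.apply v = v ∧
    ∀ v' : Word, u <+: v' → t.apply v' = v' → v.length ≤ v'.length

/-- `w` is the sequence of prefixes associated with the directive bi-sequence
`(Δ, Θ)`: `w 0 = ε` and `w (n+1) = (w n · δ_{n+1})^{ϑ_{n+1}}`. -/
def DirectivePrefixes (Δ : ℕ → Letter) (Θ : ℕ → AM) (w : ℕ → Word) : Prop :=
  w 0 = [] ∧ ∀ n : ℕ, IsPalClosure (Θ (n + 1)) (w n ++ [Δ (n + 1)]) (w (n + 1))

/-- A pseudopalindromic prefix `v` of `w_{n+1}` is missed between `w_n` and `w_{n+1}`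
if `|w_n| < |v| < |w_{n+1}|`. -/
def MissedBetween (wn wn1 v : Word) : Prop :=
  v <+: wn1 ∧ IsPseudopal v ∧ wn.length < v.length ∧ v.length < wn1.length

/-- An image of `u` occurs in `v` at (0-indexed) position `p`. -/
def OccursImageAt (u v : Word) (p : ℕ) : Prop :=
  p + u.length ≤ v.length ∧ IsImage u ((v.drop p).take u.length)

/-- Assumption A for the pair `(wn, wn1)`: some image of `wn` occurs in `wn1`
at a position `p` with `0 < p < |wn1| - |wn|`, overlapping both the prefix
occurrence of `wn` and the suffix occurrence of an image of `wn`. -/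
def AssumptionA (wn wn1 : Word) : Prop :=
  ∃ p : ℕ, 0 < p ∧ p < wn1.length - wn.length ∧ p < wn.length ∧
    wn1.length - wn.length < p + wn.length ∧ OccursImageAt wn wn1 p

/-- The prefix of length `n` of the directive bi-sequence is normalized:
every pseudopalindromic prefix of `w n` equals `w k` for some `k ≤ n`. -/
def NormalizedUpTo (w : ℕ → Word) (n : ℕ) : Prop :=
  ∀ v : Word, v <+: w n → IsPseudopal v → ∃ k : ℕ, k ≤ n ∧ v = w k

/-- `rep u l` is the `l`-fold concatenation `u^l`. -/
def rep (u : Word) (l : ℕ) : Word := (List.replicate l u).flatten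

/-- `rmSuf x y` is `x · y⁻¹`: the word `x` with its suffix of length `|y|` removed. -/
def rmSuf (x y : Word) : Word := x.take (x.length - y.length)

/-- `v` is a prefix of the infinite periodic word `pat^ω`. -/
def IsPrefixOfPow (pat v : Word) : Prop :=
  ∀ q : ℕ, ∀ hq : q < v.length, ∃ hp : q % pat.length < pat.length,
    v.get ⟨q, hq⟩ = pat.get ⟨q % pat.length, hp⟩

open Equiv (Perm)

/-- The prefix of length `l` of `f` is mapped to itself by reversal followed by `π`. -/
def PalPrefix (f : ℕ → Letter) (π : Perm Letter) (l : ℕ) : Prop :=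
  ∀ i j, i + j + 1 = l → f j = π (f i)

/-- The prefix of length `N` of `f` has the period `p` up to the letter permutation `σ`. -/
def TwistedPeriod (f : ℕ → Letter) (σ : Perm Letter) (p N : ℕ) : Prop :=
  ∀ i, i + p < N → f (i + p) = σ (f i)

theorem perm_letter_commute_of_apply_eq :
    ∀ (σ τ : Perm Letter) (x : Letter), σ (τ x) = τ (σ x) → ∀ y, σ (τ y) = τ (σ y) := by
  decide

theorem perm_letter_conj_of_apply_eq :
    ∀ (σ π : Perm Letter) (x : Letter), σ (π (σ x)) = π x → ∀ y, σ (π (σ y)) = π y := by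
  decide

theorem exists_letter_eq_of_perm_apply_apply_eq :
    ∀ (π : Perm Letter) (x : Letter), π (π x) = x →
      (∀ y, π y = y) ∨ ∃ i : Letter, ∀ y, π y = -(i + y) := by
  decide

theorem AM.letter_letter (t : AM) (a : Letter) : t.letter (t.letter a) = a := by
  cases t <;> simp [AM.letter]

/-- The letter permutation underlying an antimorphism. -/
def AM.perm (t : AM) : Perm Letter := ⟨t.letter, t.letter, t.letter_letter, t.letter_letter⟩

theorem AM.length_apply (t : AM) (w : Word) : (t.apply w).length = w.length := by
  simp [AM.apply]

theorem exists_am_perm_eq (π : Perm Letter) (x : Letter) (h : π (π x) = x) :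
    ∃ t : AM, ∀ y, t.letter y = π y := by
  rcases exists_letter_eq_of_perm_apply_apply_eq π x h with h | ⟨i, h⟩
  · exact ⟨.R, fun y => (h y).symm⟩
  · exact ⟨.E i, fun y => (h y).symm⟩

theorem palPrefix_of_isPrefix {W v : Word} (hv : v <+: W) {t : AM} (ht : t.apply v = v) :
    PalPrefix (fun i => W.getD i 0) t.perm v.length := by
  intro i j hij
  obtain ⟨s, rfl⟩ := hv
  have hi : i < v.length := by omega
  have hj : j < v.length := by omega
  have key : v[j] = t.letter v[i] := by
    have h : (t.apply v)[j]'(by rw [t.length_apply]; exact hj) = v[j] := by simp only [ht]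
    rw [← h]
    simp only [AM.apply, List.getElem_reverse, List.getElem_map, List.length_map]
    congr 2
    omega
  simp only [List.getD_eq_getElem?_getD, List.getElem?_append_left hi,
    List.getElem?_append_left hj, List.getElem?_eq_getElem hi, List.getElem?_eq_getElem hj,
    Option.getD_some]
  exact key

theorem isPseudopal_take {W : Word} {π : Perm Letter} {l : ℕ} (hl : l ≤ W.length)
    (h : PalPrefix (fun i => W.getD i 0) π l) : IsPseudopal (W.take l) := by
  rcases Nat.eq_zero_or_pos l with rfl | hpos
  · exact ⟨.R, by simp [AM.apply]⟩
  have h1 := h 0 (l - 1) (by omega)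
  have h2 := h (l - 1) 0 (by omega)
  obtain ⟨t, ht⟩ := exists_am_perm_eq π _ (by rw [← h1]; exact h2.symm)
  refine ⟨t, List.ext_getElem (t.length_apply _) fun j hj hj' => ?_⟩
  have hjl : j < l := by rw [List.length_take] at hj'; omega
  have h3 := h (l - 1 - j) j (by omega)
  simp only [List.getD_eq_getElem?_getD, List.getElem?_eq_getElem (show j < W.length by omega),
    List.getElem?_eq_getElem (show l - 1 - j < W.length by omega), Option.getD_some] at h3
  simp only [AM.apply, List.getElem_reverse, List.getElem_map, List.getElem_take, ht,
    List.length_map, List.length_take, min_eq_left hl]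
  exact h3.symm

section TwistedPeriod

variable {f : ℕ → Letter} {σ τ π ρ : Perm Letter} {p q l m N : ℕ}

theorem TwistedPeriod.mono (h : TwistedPeriod f σ p N) (hm : m ≤ N) : TwistedPeriod f σ p m :=
  fun i hi => h i (by omega)

theorem PalPrefix.twistedPeriod (h : PalPrefix f π l) (h' : PalPrefix f ρ m) (hlm : l ≤ m) :
    TwistedPeriod f (ρ * π) (m - l) m := by
  intro i hi
  rw [Equiv.Perm.mul_apply, ← h i (l - 1 - i) (by omega)]
  exact h' _ _ (by omega)

theorem TwistedPeriod.commute (hp : TwistedPeriod f σ p N) (hq : TwistedPeriod f τ q N)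
    (hN : p + q < N) (y : Letter) : σ (τ y) = τ (σ y) := by
  refine perm_letter_commute_of_apply_eq σ τ (f 0) ?_ y
  rw [← hp 0 (by omega), ← hq 0 (by omega), ← hp _ (by omega), ← hq _ (by omega)]
  congr 1
  omega

theorem TwistedPeriod.sub (hp : TwistedPeriod f σ p N) (hq : TwistedPeriod f τ q N)
    (hN : p + q < N) (hpq : p ≤ q) : TwistedPeriod f (σ⁻¹ * τ) (q - p) N := by
  intro i hi
  rw [Equiv.Perm.mul_apply, Equiv.Perm.eq_inv_iff_eq]
  by_cases h : p ≤ i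
  · have h1 := hp (i - p) (by omega)
    have h2 := hq (i - p) (by omega)
    rw [show i - p + p = i by omega] at h1
    rw [show i - p + q = i + (q - p) by omega] at h2
    rw [h1, h2, hp.commute hq hN]
  · rw [← hp _ (by omega), ← hq _ (by omega)]
    congr 1
    omega

theorem TwistedPeriod.extend (hp : TwistedPeriod f σ p m) (hq : TwistedPeriod f τ q N)
    (hm : m ≤ N) (hq0 : 0 < q) (hpq : p + q < m) : TwistedPeriod f σ p N := by
  intro i
  induction i using Nat.strong_induction_on with
  | _ i ih =>
    intro hi
    by_cases h : i + p < m
    · exact hp i h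
    · have h1 := hq (i - q) (by omega)
      have h2 := hq (i - q + p) (by omega)
      rw [show i - q + q = i by omega] at h1
      rw [show i - q + p + q = i + p by omega] at h2
      rw [h1, h2, ih _ (by omega) (by omega), hp.commute (hq.mono hm) hpq]

theorem TwistedPeriod.dvd_of_minimal (hp : TwistedPeriod f σ p N)
    (hmin : ∀ r, 0 < r → ∀ τ, TwistedPeriod f τ r N → p ≤ r) (hp0 : 0 < p)
    (hq : TwistedPeriod f τ q N) (hN : p + q < N) : p ∣ q := by
  induction q using Nat.strong_induction_on generalizing τ with
  | _ q ih =>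
    rcases Nat.eq_zero_or_pos q with rfl | hq0
    · exact dvd_zero p
    · have hle := hmin q hq0 τ hq
      exact (Nat.dvd_sub_iff_left hle dvd_rfl).1
        (ih (q - p) (by omega) (hp.sub hq hN hle) (by omega))

theorem PalPrefix.add_period (h : PalPrefix f π l) (hp : TwistedPeriod f σ p N)
    (hN : l + p ≤ N) (hpl : p < l) : PalPrefix f (σ * π) (l + p) := by
  intro i j hij
  rw [Equiv.Perm.mul_apply]
  by_cases hj : p ≤ j
  · have h1 := hp (j - p) (by omega)
    rw [Nat.sub_add_cancel hj] at h1
    rw [h1, h i (j - p) (by omega)]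
  · have h1 := hp (i - p) (by omega)
    rw [show i - p + p = i by omega] at h1
    rw [h1, h (i - p) j (by omega)]
    refine (perm_letter_conj_of_apply_eq σ π (f 0) ?_ _).symm
    rw [← hp 0 (by omega), ← h (0 + p) (l - 1 - p) (by omega), ← hp _ (by omega)]
    exact h _ _ (by omega)

theorem PalPrefix.sub_period (h : PalPrefix f π l) (hp : TwistedPeriod f σ p l) :
    PalPrefix f (σ⁻¹ * π) (l - p) := by
  intro i j hij
  rw [Equiv.Perm.mul_apply, Equiv.Perm.eq_inv_iff_eq, ← hp j (by omega)]
  exact h _ _ (by omega)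

end TwistedPeriod

/-- Three palindromic prefixes of lengths `l + a < l + a + b < l + a + b + c < 2 * l` extending a
palindromic prefix of length `l`, with no other one in between, are equally spaced, and their
spacing is the least twisted period of the prefix of length `l`. -/
theorem PalPrefix.equally_spaced {f : ℕ → Letter} {l a b c : ℕ} {π π₁ π₂ π₃ : Perm Letter}
    (h : PalPrefix f π l) (h₁ : PalPrefix f π₁ (l + a)) (h₂ : PalPrefix f π₂ (l + a + b))
    (h₃ : PalPrefix f π₃ (l + a + b + c)) (ha : 0 < a) (hb : 0 < b) (hc : 0 < c)
    (hl : a + b + c < l)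
    (hexact : ∀ m ρ, PalPrefix f ρ m → l < m → m < l + a + b + c →
      m = l + a ∨ m = l + a + b) :
    b = a ∧ c = a ∧ (∃ σ, TwistedPeriod f σ a l) ∧
      ∀ r, 0 < r → ∀ τ, TwistedPeriod f τ r l → a ≤ r := by
  classical
  have Pa := h.twistedPeriod h₁ (by omega)
  have Pbc := (h₁.twistedPeriod h₃ (by omega)).mono (show l ≤ _ by omega)
  have Pc := h₂.twistedPeriod h₃ (by omega)
  rw [show l + a - l = a by omega] at Pa
  rw [show l + a + b + c - (l + a) = b + c by omega] at Pbc
  rw [show l + a + b + c - (l + a + b) = c by omega] at Pc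
  have hex : ∃ r, 0 < r ∧ ∃ τ, TwistedPeriod f τ r l := ⟨a, ha, _, Pa.mono (by omega)⟩
  obtain ⟨hg0, σ, hσ⟩ := Nat.find_spec hex
  have hmin : ∀ r, 0 < r → ∀ τ, TwistedPeriod f τ r l → Nat.find hex ≤ r :=
    fun r hr τ hτ => Nat.find_min' hex ⟨hr, τ, hτ⟩
  generalize Nat.find hex = g at hg0 hσ hmin
  have hga := hmin a ha _ (Pa.mono (by omega))
  have hgc := hmin c hc _ (Pc.mono (by omega))
  have dc := hσ.dvd_of_minimal hmin hg0 (Pc.mono (by omega)) (by omega)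
  have dbc := hσ.dvd_of_minimal hmin hg0 Pbc (by omega)
  have hgb := Nat.le_of_dvd hb ((Nat.dvd_add_iff_left dc).2 dbc)
  have hσ' := hσ.extend Pc (by omega) hc (by omega)
  have q₁ := h.add_period hσ' (by omega) (by omega)
  have q₂ := q₁.add_period hσ' (by omega) (by omega)
  have q₃ := q₂.add_period hσ' (by omega) (by omega)
  have e₁ := hexact _ _ q₁ (by omega) (by omega)
  obtain rfl : g = a := by omega
  have e₂ := hexact _ _ q₂ (by omega) (by omega)
  obtain rfl : b = g := by omega
  refine ⟨rfl, ?_, ⟨σ, hσ⟩, hmin⟩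
  by_contra hne
  have e₃ := hexact _ _ q₃ (by omega) (by omega)
  omega

theorem DirectivePrefixes.isPrefix {Δ : ℕ → Letter} {Θ : ℕ → AM} {w : ℕ → Word}
    (hw : DirectivePrefixes Δ Θ w) {k n : ℕ} (hkn : k ≤ n) : w k <+: w n := by
  induction n, hkn using Nat.le_induction with
  | base => exact List.prefix_refl _
  | succ n _ ih => exact ih.trans ((List.prefix_append _ _).trans (hw.2 n).1)

theorem DirectivePrefixes.strictMono_length {Δ : ℕ → Letter} {Θ : ℕ → AM} {w : ℕ → Word}
    (hw : DirectivePrefixes Δ Θ w) : StrictMono fun n => (w n).length := by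
  refine strictMono_nat_of_lt_succ fun n => ?_
  have := (hw.2 n).1.length_le
  simp only [List.length_append, List.length_singleton] at this
  omega

theorem DirectivePrefixes.isPseudopal {Δ : ℕ → Letter} {Θ : ℕ → AM} {w : ℕ → Word}
    (hw : DirectivePrefixes Δ Θ w) (n : ℕ) : IsPseudopal (w n) := by
  cases n with
  | zero => exact ⟨.R, by simp [hw.1, AM.apply]⟩
  | succ n => exact ⟨_, (hw.2 n).2.1⟩

theorem AM.isImage_drop {t : AM} {u v : Word} (ht : t.apply u = u) (hv : v <+: u) :
    IsImage v (u.drop (u.length - v.length)) := by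
  obtain ⟨s, rfl⟩ := hv
  refine ⟨t, ?_⟩
  have h : v ++ s = t.apply s ++ t.apply v := by
    rw [← ht]
    simp [AM.apply]
  have hlen : (v ++ s).length - v.length = (t.apply s).length := by
    simp [t.length_apply]
  rw [hlen, h, List.drop_left]


/-- Lemma: if exactly two pseudopalindromic prefixes `v₁, v₂` (`|v₁| < |v₂|`) are
missed between `w n` and `w (n+1)`, `|v₂| < 2|w n|` and moreover
`|w (n+1)| < 2|w n|`, then the suffix of `w n` of length `2|w n| - |v₂|` is an
image of `w (n-2)`; in particular `|v₂| = 2|w n| - |w (n-2)|`. -/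
theorem second_overlap_is_image_of_second_previous_prefix
    (Δ : ℕ → Letter) (Θ : ℕ → AM) (w : ℕ → Word)
    (hw : DirectivePrefixes Δ Θ w) (n : ℕ) (hn : 2 ≤ n)
    (hnorm : NormalizedUpTo w n)
    (v₁ v₂ : Word) (hlen : v₁.length < v₂.length)
    (h₁ : MissedBetween (w n) (w (n + 1)) v₁)
    (h₂ : MissedBetween (w n) (w (n + 1)) v₂)
    (hexact : ∀ v : Word, MissedBetween (w n) (w (n + 1)) v → v = v₁ ∨ v = v₂)
    (hover : v₂.length < 2 * (w n).length)
    (hover' : (w (n + 1)).length < 2 * (w n).length) :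
    IsImage (w (n - 2))
        ((w n).drop ((w n).length - (2 * (w n).length - v₂.length))) ∧
      v₂.length = 2 * (w n).length - (w (n - 2)).length := by
  set W := w (n + 1) with hW
  set f : ℕ → Letter := fun i => W.getD i 0
  have hmono := hw.strictMono_length
  have hpal : ∀ k ≤ n + 1, ∃ π, PalPrefix f π (w k).length := fun k hk => by
    obtain ⟨t, ht⟩ := hw.isPseudopal k
    exact ⟨_, palPrefix_of_isPrefix (hw.isPrefix hk) ht⟩
  obtain ⟨π, hπ⟩ := hpal n (by omega)
  obtain ⟨π₃, hπ₃⟩ := hpal (n + 1) le_rfl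
  obtain ⟨p₁, ⟨t₁, ht₁⟩, l₁, -⟩ := h₁
  obtain ⟨p₂, ⟨t₂, ht₂⟩, -, l₂'⟩ := h₂
  have hπ₁ := palPrefix_of_isPrefix p₁ ht₁
  have hπ₂ := palPrefix_of_isPrefix p₂ ht₂
  obtain ⟨a, ha⟩ := Nat.exists_eq_add_of_lt l₁
  obtain ⟨b, hb⟩ := Nat.exists_eq_add_of_lt hlen
  obtain ⟨c, hc⟩ := Nat.exists_eq_add_of_lt l₂'
  rw [Nat.add_assoc] at ha hb hc
  rw [ha] at hb
  rw [hb] at hc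
  rw [← hW, hc] at hπ₃
  rw [hb] at hπ₂
  rw [ha] at hπ₁
  obtain ⟨hba, hca, ⟨σ, hσ⟩, hmin⟩ := hπ.equally_spaced hπ₁ hπ₂ hπ₃ (by omega) (by omega)
    (by omega) (by omega) fun m ρ hm hlm hmu => by
      have hmW : m ≤ W.length := by omega
      have hlm' : (W.take m).length = m := by simp [hmW]
      rcases hexact (W.take m) ⟨List.take_prefix _ _, isPseudopal_take hmW hm, by omega,
        by omega⟩ with h | h
      · exact .inl (by rw [← hlm', h, ha])
      · exact .inr (by rw [← hlm', h, hb])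
  rw [hba] at hb hc
  rw [hca] at hc
  generalize a + 1 = g at *
  have hshort : ∀ m ρ, m < (w n).length → PalPrefix f ρ m → ∃ k < n, (w k).length = m := by
    intro m ρ hm hρ
    have hpre : W.take m <+: w n := List.prefix_of_prefix_length_le (List.take_prefix _ _)
      (hw.isPrefix (Nat.le_succ n)) (by rw [List.length_take]; omega)
    obtain ⟨k, hk, hkm⟩ := hnorm _ hpre (isPseudopal_take (by omega) hρ)
    have hkl : (w k).length = m := by rw [← hkm, List.length_take]; omega
    exact ⟨k, hmono.lt_iff_lt.1 (show (w k).length < (w n).length by omega), hkl⟩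
  have s₁ := hπ.sub_period hσ
  have s₂ := s₁.sub_period (hσ.mono (Nat.sub_le _ _))
  obtain ⟨k₁, hk₁, hl₁⟩ := hshort _ _ (by omega) s₁
  obtain ⟨k₂, hk₂, hl₂⟩ := hshort _ _ (by omega) s₂
  have hk₂₁ : k₂ < k₁ := hmono.lt_iff_lt.1 (show (w k₂).length < (w k₁).length by omega)
  have hge : (w k₂).length ≤ (w (n - 2)).length := hmono.monotone (show k₂ ≤ n - 2 by omega)
  have hlt₁ : (w (n - 2)).length < (w (n - 1)).length := hmono (show n - 2 < n - 1 by omega)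
  have hlt₂ : (w (n - 1)).length < (w n).length := hmono (show n - 1 < n by omega)
  obtain ⟨ρ₁, hρ₁⟩ := hpal (n - 1) (by omega)
  obtain ⟨ρ₂, hρ₂⟩ := hpal (n - 2) (by omega)
  have P₁ := hρ₁.twistedPeriod hπ hlt₂.le
  have P₂ := hρ₂.twistedPeriod hπ (by omega)
  have m₁ := hmin _ (by omega) _ P₁
  obtain ⟨d, hd⟩ := hσ.dvd_of_minimal hmin (by omega) P₂ (by omega)
  have hd2 : 2 ≤ d := by
    by_contra hd2
    have : g * d ≤ g * 1 := Nat.mul_le_mul_left g (by omega)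
    omega
  have hgd : g * 2 ≤ g * d := Nat.mul_le_mul_left g hd2
  obtain ⟨t, ht⟩ := hw.isPseudopal n
  have hlen₂ : v₂.length = 2 * (w n).length - (w (n - 2)).length := by omega
  refine ⟨?_, hlen₂⟩
  rw [show 2 * (w n).length - v₂.length = (w (n - 2)).length by omega]
  exact AM.isImage_drop ht (hw.isPrefix (Nat.sub_le n 2))
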